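/- arXiv:2604.01717 — 2 statements merged into one kernel-verified Lean document; each statement's English description precedes it below -/
import Mathlib

section
/- Let G be a graph on n vertices and let λ > 0. Let I be a random independent set drawn from the hard-core model on G at activity λ, i.e. Pr[I] = λ^{|I|}/P_G(λ). Then the variance of |I| satisfies Var(|I|) ≥ nλ/(1+nλ)^2. Equivalently, (Σ_{I indep} |I|^2 λ^{|I|})/P_G(λ) − ( (Σ_{I indep} |I| λ^{|I|})/P_G(λ) )^2 ≥ nλ/(1+nλ)^2. In particular the variance fraction satisfies V_G(λ) ≥ V_{K_n}(λ) = λ/(1+nλ)^2. -/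
open Finset

/- The finset of all independent sets (as finsets of vertices) of a graph `G`. -/
open Classical in
noncomputable def indepFinsets {V : Type*} [Fintype V] (G : SimpleGraph V) :
    Finset (Finset V) :=
  Finset.univ.filter fun s => ∀ u ∈ s, ∀ v ∈ s, ¬ G.Adj u v

/- The independence polynomial `P_G(x) = Σ_{I independent} x^{|I|}`. -/
noncomputable def indepPoly {V : Type*} [Fintype V] (G : SimpleGraph V) (x : ℝ) : ℝ :=
  ∑ I ∈ indepFinsets G, x ^ I.card

open Classical in
/-- The number of independent sets of size `k`. -/
noncomputable def indepCount {V : Type*} [Fintype V] (G : SimpleGraph V) (k : ℕ) : ℕ :=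
  ((indepFinsets G).filter fun s => s.card = k).card

lemma mem_indepFinsets {V : Type*} [Fintype V] {G : SimpleGraph V} {s : Finset V} :
    s ∈ indepFinsets G ↔ ∀ u ∈ s, ∀ v ∈ s, ¬ G.Adj u v := by
  simp [indepFinsets]

lemma indepCount_zero {V : Type*} [Fintype V] (G : SimpleGraph V) : indepCount G 0 = 1 := by
  classical
  rw [indepCount, Finset.card_eq_one]
  refine ⟨∅, ?_⟩
  ext s
  simp only [mem_filter, mem_indepFinsets, card_eq_zero, mem_singleton]
  refine ⟨fun h => h.2, ?_⟩
  rintro rfl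
  simp

lemma indepCount_one {V : Type*} [Fintype V] (G : SimpleGraph V) :
    indepCount G 1 = Fintype.card V := by
  classical
  rw [indepCount, ← Finset.card_univ,
    ← Finset.card_image_of_injective univ (Finset.singleton_injective (α := V))]
  congr 1
  ext s
  simp only [mem_filter, mem_indepFinsets, card_eq_one, mem_image, mem_univ, true_and]
  constructor
  · rintro ⟨-, v, rfl⟩
    exact ⟨v, rfl⟩
  · rintro ⟨v, rfl⟩
    exact ⟨by simp, v, rfl⟩

/-- Every independent set of size `k + 1` arises by adding a vertex to one of size `k`. -/
lemma indepCount_succ_le {V : Type*} [Fintype V] (G : SimpleGraph V) (k : ℕ) :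
    indepCount G (k + 1) ≤ Fintype.card V * indepCount G k := by
  classical
  rw [indepCount, indepCount, ← Finset.card_univ, ← Finset.card_product]
  refine (Finset.card_le_card ?_).trans
    (Finset.card_image_le (f := fun p : V × Finset V => insert p.1 p.2))
  intro s hs
  simp only [mem_filter, mem_indepFinsets] at hs
  obtain ⟨hind, hcard⟩ := hs
  obtain ⟨v, hv⟩ : s.Nonempty := Finset.card_pos.1 (by omega)
  simp only [mem_image, mem_product, mem_filter, mem_univ, true_and, mem_indepFinsets]
  refine ⟨(v, s.erase v), ⟨fun a ha b hb => ?_, ?_⟩, Finset.insert_erase hv⟩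
  · exact hind a (Finset.mem_of_mem_erase ha) b (Finset.mem_of_mem_erase hb)
  · simp [Finset.card_erase_of_mem hv, hcard]

lemma sum_indepFinsets_card {V : Type*} [Fintype V] (G : SimpleGraph V) (f : ℕ → ℝ) :
    ∑ I ∈ indepFinsets G, f I.card =
      ∑ k ∈ range (Fintype.card V + 2), f k * indepCount G k := by
  classical
  rw [← Finset.sum_fiberwise_of_maps_to (s := indepFinsets G) (g := Finset.card)
    (t := range (Fintype.card V + 2))]
  · refine Finset.sum_congr rfl fun k _ => ?_
    rw [Finset.sum_congr rfl fun I hI => congrArg f (Finset.mem_filter.1 hI).2,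
      Finset.sum_const, nsmul_eq_mul, mul_comm, indepCount]
  · intro I _
    have := Finset.card_le_univ I
    simp only [mem_range]
    omega

/-- Adding to a measure of mass `Z`, first moment `A` and second moment `Q` an atom of mass
`w ≤ t * Z` at a point `k` exceeding the mean by at least one preserves the variance bound. -/
lemma variance_bound_add_atom {t Z A Q w k : ℝ} (ht : 0 ≤ t) (hZ : 0 < Z) (hw : 0 ≤ w)
    (hwZ : w ≤ t * Z) (hk : Z ≤ k * Z - A)
    (h : t / (1 + t) ^ 2 * Z ^ 2 ≤ Q * Z - A ^ 2) :
    t / (1 + t) ^ 2 * (Z + w) ^ 2 ≤ (Q + k ^ 2 * w) * (Z + w) - (A + k * w) ^ 2 := by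
  set s := t / (1 + t) ^ 2 with hs
  have hs0 : 0 ≤ s := by positivity
  have hs1 : s * (1 + t) ≤ 1 := by
    have : s * (1 + t) = t / (1 + t) := by rw [hs]; field_simp
    rw [this, div_le_one (by positivity)]
    linarith
  have hsw : s * (Z + w) ≤ Z := calc
    s * (Z + w) ≤ s * (Z + t * Z) := by gcongr
    _ = s * (1 + t) * Z := by ring
    _ ≤ 1 * Z := by gcongr
    _ = Z := one_mul Z
  have hsq : Z ^ 2 ≤ (k * Z - A) ^ 2 := by gcongr
  have hatom : s * Z + Z ≤ Q + k ^ 2 * Z - 2 * k * A := by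
    refine le_of_mul_le_mul_right ?_ hZ
    nlinarith
  have : w * (s * (2 * Z + w)) ≤ w * (Q + k ^ 2 * Z - 2 * k * A) :=
    mul_le_mul_of_nonneg_left (by linarith) hw
  nlinarith

lemma variance_bound_range {w : ℕ → ℝ} {t : ℝ} (ht : 0 ≤ t) (hw : ∀ k, 0 ≤ w k)
    (h0 : w 0 = 1) (h1 : w 1 = t) (hsucc : ∀ k, w (k + 1) ≤ t * w k) (N : ℕ) :
    t / (1 + t) ^ 2 * (∑ k ∈ range (N + 2), w k) ^ 2 ≤
      (∑ k ∈ range (N + 2), (k : ℝ) ^ 2 * w k) * (∑ k ∈ range (N + 2), w k) -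
        (∑ k ∈ range (N + 2), (k : ℝ) * w k) ^ 2 := by
  induction N with
  | zero =>
    simp only [zero_add, Finset.sum_range_succ, Finset.sum_range_zero, h0, h1]
    have : t / (1 + t) ^ 2 * (1 + t) ^ 2 = t := by field_simp
    push_cast
    linarith
  | succ N ih =>
    rw [show N + 1 + 2 = (N + 2) + 1 by ring]
    simp only [Finset.sum_range_succ _ (N + 2)]
    have hle : ∀ i ∈ range (N + 2), w i ≤ ∑ k ∈ range (N + 2), w k := fun i hi =>
      Finset.single_le_sum (fun k _ => hw k) hi
    have hZ : 0 < ∑ k ∈ range (N + 2), w k := by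
      have := hle 0 (by simp)
      linarith
    refine variance_bound_add_atom ht hZ (hw _) ?_ ?_ ih
    · exact (hsucc (N + 1)).trans (mul_le_mul_of_nonneg_left (hle _ (by simp)) ht)
    · rw [Finset.mul_sum, ← Finset.sum_sub_distrib]
      refine Finset.sum_le_sum fun k hk => ?_
      have hk' : (k : ℝ) + 1 ≤ ((N + 2 : ℕ) : ℝ) := by
        exact_mod_cast Finset.mem_range.1 hk
      nlinarith [hw k]

/-- Theorem 4: for an `n`-vertex graph `G` and `λ > 0`, the variance of the size of a random
independent set from the hard-core model satisfies
`Var(|I|) = E[|I|²] − (E[|I|])² ≥ nλ/(1+nλ)²`, i.e. `V_G(λ) ≥ V_{K_n}(λ) = λ/(1+nλ)²`. -/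
theorem variance_lower_bound_Kn {V : Type*} [Fintype V] (G : SimpleGraph V)
    (n : ℕ) (hn : Fintype.card V = n) (lam : ℝ) (hlam : 0 < lam) :
    (∑ I ∈ indepFinsets G, (I.card : ℝ) ^ 2 * lam ^ I.card) / indepPoly G lam -
        ((∑ I ∈ indepFinsets G, (I.card : ℝ) * lam ^ I.card) / indepPoly G lam) ^ 2 ≥
      (n : ℝ) * lam / (1 + (n : ℝ) * lam) ^ 2 := by
  subst hn
  set n := Fintype.card V with hn
  set w : ℕ → ℝ := fun k => lam ^ k * indepCount G k with hwdef
  have hP : indepPoly G lam = ∑ k ∈ range (n + 2), w k :=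
    sum_indepFinsets_card G fun k => lam ^ k
  have hA : ∑ I ∈ indepFinsets G, (I.card : ℝ) * lam ^ I.card =
      ∑ k ∈ range (n + 2), (k : ℝ) * w k := by
    rw [sum_indepFinsets_card G fun k => (k : ℝ) * lam ^ k]
    simp only [hwdef, mul_assoc, hn]
  have hQ : ∑ I ∈ indepFinsets G, (I.card : ℝ) ^ 2 * lam ^ I.card =
      ∑ k ∈ range (n + 2), (k : ℝ) ^ 2 * w k := by
    rw [sum_indepFinsets_card G fun k => (k : ℝ) ^ 2 * lam ^ k]
    simp only [hwdef, mul_assoc, hn]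
  have hw : ∀ k, 0 ≤ w k := fun k => by positivity
  have h0 : w 0 = 1 := by simp [hwdef, indepCount_zero]
  have h1 : w 1 = n * lam := by simp [hwdef, indepCount_one, hn, mul_comm]
  have hsucc : ∀ k, w (k + 1) ≤ n * lam * w k := fun k => by
    have h : (indepCount G (k + 1) : ℝ) ≤ n * indepCount G k := by
      exact_mod_cast indepCount_succ_le G k
    calc w (k + 1) ≤ lam ^ (k + 1) * (n * indepCount G k) :=
          mul_le_mul_of_nonneg_left h (by positivity)
      _ = n * lam * w k := by simp only [hwdef]; ring
  have key := variance_bound_range (by positivity) hw h0 h1 hsucc n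
  have hZ : 0 < ∑ k ∈ range (n + 2), w k := by
    have := Finset.single_le_sum (fun k _ => hw k) (show 0 ∈ range (n + 2) by simp)
    linarith
  rw [hP, hA, hQ, ge_iff_le, div_pow, div_sub_div _ _ hZ.ne' (by positivity),
    le_div_iff₀ (by positivity)]
  nlinarith [mul_le_mul_of_nonneg_left key hZ.le]
end

section
/- Let n be a positive integer and 0 < p < 1. Write b_r = C(n,r)p^r(1−p)^{n−r} and F_r = Σ_{k=0}^{r} b_k. Then for all 0 ≤ r ≤ n−1, the ratio F_r/b_r is non-decreasing in r, i.e. F_{r+1}/b_{r+1} ≥ F_r/b_r; equivalently the hazard-type ratio h_r = b_r/F_r is non-increasing: h_{r+1} ≤ h_r. -/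
open Finset

/- The binomial probability mass function `b_r = C(n,r) p^r (1−p)^{n−r}`. -/
noncomputable def binomPMF (n : ℕ) (p : ℝ) (r : ℕ) : ℝ :=
  (n.choose r : ℝ) * p ^ r * (1 - p) ^ (n - r)

lemma binomPMF_nonneg {n : ℕ} {p : ℝ} (hp0 : 0 ≤ p) (hp1 : p ≤ 1) (k : ℕ) :
    0 ≤ binomPMF n p k :=
  mul_nonneg (mul_nonneg (Nat.cast_nonneg _) (pow_nonneg hp0 _)) (pow_nonneg (sub_nonneg.2 hp1) _)

lemma binomPMF_pos {n : ℕ} {p : ℝ} (hp0 : 0 < p) (hp1 : p < 1) {k : ℕ} (hk : k ≤ n) :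
    0 < binomPMF n p k :=
  mul_pos (mul_pos (Nat.cast_pos.2 (Nat.choose_pos hk)) (pow_pos hp0 _))
    (pow_pos (sub_pos.2 hp1) _)

lemma binomPMF_succ_mul {n k : ℕ} (p : ℝ) (hk : k < n) :
    binomPMF n p (k + 1) * ((k + 1) * (1 - p)) = binomPMF n p k * ((n - k) * p) := by
  have hchoose : (n.choose (k + 1) : ℝ) * (k + 1) = n.choose k * (n - k) := by
    rw [← Nat.cast_sub hk.le]
    exact_mod_cast Nat.choose_succ_right_eq n k
  have hexp : n - k = n - (k + 1) + 1 := by omega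
  simp only [binomPMF, hexp, pow_succ]
  linear_combination p ^ k * p * (1 - p) ^ (n - (k + 1)) * (1 - p) * hchoose

/-- The binomial probability mass function has decreasing consecutive ratios. -/
lemma binomPMF_mul_succ_le {n k r : ℕ} {p : ℝ} (hp0 : 0 ≤ p) (hp1 : p < 1)
    (hkr : k ≤ r) (hr : r < n) :
    binomPMF n p k * binomPMF n p (r + 1) ≤ binomPMF n p (k + 1) * binomPMF n p r := by
  have hc : (0 : ℝ) < (k + 1) * (r + 1) * (1 - p) :=
    mul_pos (by positivity) (sub_pos.2 hp1)
  have hb : 0 ≤ binomPMF n p k * binomPMF n p r * p :=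
    mul_nonneg (mul_nonneg (binomPMF_nonneg hp0 hp1.le k) (binomPMF_nonneg hp0 hp1.le r)) hp0
  have hkr' : (k : ℝ) ≤ r := by exact_mod_cast hkr
  have hcoef : ((n : ℝ) - r) * (k + 1) ≤ (n - k) * (r + 1) := by
    nlinarith [(n.cast_nonneg : (0 : ℝ) ≤ n)]
  refine le_of_mul_le_mul_right ?_ hc
  linear_combination mul_le_mul_of_nonneg_left hcoef hb + binomPMF n p k * (k + 1) * binomPMF_succ_mul p hr
    - binomPMF n p r * (r + 1) * binomPMF_succ_mul p (hkr.trans_lt hr)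

/-- For a binomial distribution with parameters `n` and `0 < p < 1`, the ratio
`F_r / b_r` of the CDF to the PMF is non-decreasing in `r` for `0 ≤ r ≤ n−1`:
`F_{r+1}/b_{r+1} ≥ F_r/b_r` (equivalently, the hazard-type ratio `h_r = b_r/F_r` is
non-increasing). -/
theorem binomial_cdf_pmf_ratio_mono (n : ℕ) (hn : 0 < n)
    (p : ℝ) (hp0 : 0 < p) (hp1 : p < 1) (r : ℕ) (hr : r + 1 ≤ n) :
    (∑ k ∈ Finset.range (r + 1), binomPMF n p k) / binomPMF n p r ≤
      (∑ k ∈ Finset.range (r + 2), binomPMF n p k) / binomPMF n p (r + 1) := by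
  rw [div_le_div_iff₀ (binomPMF_pos hp0 hp1 (by omega)) (binomPMF_pos hp0 hp1 hr),
    sum_range_succ' _ (r + 1), add_mul, sum_mul, sum_mul]
  refine le_add_of_le_of_nonneg (sum_le_sum fun k hk => ?_)
    (mul_nonneg (binomPMF_nonneg hp0.le hp1.le _) (binomPMF_nonneg hp0.le hp1.le _))
  exact binomPMF_mul_succ_le hp0.le hp1 (Nat.lt_succ_iff.1 (mem_range.1 hk)) hr
end
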